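/- (Orthogonality of generalized q-binomial coefficients, equation (3.9) of the paper) For all compositions u, w ∈ ℕ^n, Σ_v (τ_v/τ_u) [u; v] [v; w]_{q⁻¹,t⁻¹} = δ_{uw}, where the sum is over all compositions v ∈ ℕ^n (finitely supported on |w| ≤ |v| ≤ |u|) and δ_{uw} is the Kronecker delta. -/

import Mathlib

open scoped BigOperators
open MvPolynomial

noncomputable section
namespace LRW

variable {n : ℕ}

/-- `|u|`, the weight of a composition `u ∈ ℕⁿ`. -/
def wt (u : Fin n → ℕ) : ℕ := ∑ i, u i

/-- `l'_u(i) = #{k > i : u_k > u_i} + #{k < i : u_k ≥ u_i}`. -/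
def lp (u : Fin n → ℕ) (i : Fin n) : ℕ :=
  (Finset.univ.filter fun k => i < k ∧ u i < u k).card +
  (Finset.univ.filter fun k => k < i ∧ u i ≤ u k).card

/-- The spectral vector `⟨u⟩ : ⟨u⟩_i = q^{u_i} t^{n−1−l'_u(i)}`. -/
def spec (q t : ℂ) (u : Fin n → ℕ) : Fin n → ℂ :=
  fun i => q ^ u i * t ^ (n - 1 - lp u i)

/-- Leg length `l(s)` of the cell `s = (i, j+1)` of `u` (so `j` ranges over
`0, …, u_i − 1`): `l(s) = #{k > i : j+1 ≤ u_k ≤ u_i} + #{k < i : j+1 ≤ u_k + 1 ≤ u_i}`. -/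
def leg (u : Fin n → ℕ) (i : Fin n) (j : ℕ) : ℕ :=
  (Finset.univ.filter fun k => i < k ∧ j < u k ∧ u k ≤ u i).card +
  (Finset.univ.filter fun k => k < i ∧ j ≤ u k ∧ u k < u i).card

/-- `n(u) = Σ_{s ∈ u} l(s)`. -/
def nstat (u : Fin n → ℕ) : ℕ := ∑ i, ∑ j ∈ Finset.range (u i), leg u i j

/-- `n'(u) = Σ_i C(u_i, 2)`. -/
def nstat' (u : Fin n → ℕ) : ℕ := ∑ i, Nat.choose (u i) 2

/-- `n(u⁺) = Σ_{i<j} min(u_i, u_j)`, the statistic `n` of the decreasing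
rearrangement of `u`. -/
def nplus (u : Fin n → ℕ) : ℕ := ∑ i, ∑ j, if i < j then min (u i) (u j) else 0

/-- `τ_u = (−1)^{|u|} q^{n'(u)} t^{−n(u⁺)}`. -/
def tau (q t : ℂ) (u : Fin n → ℕ) : ℂ := (-1) ^ wt u * q ^ nstat' u / t ^ nplus u

/-- The generalized q-shifted factorial `(z)_u = ∏_{s ∈ u} (1 − z q^{a'(s)} t^{−l'(s)})`. -/
def qfac (q t z : ℂ) (u : Fin n → ℕ) : ℂ :=
  ∏ i, ∏ j ∈ Finset.range (u i), (1 - z * q ^ j / t ^ lp u i)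

/-- `c'_u = ∏_{s ∈ u} (1 − q^{a(s)+1} t^{l(s)})`. -/
def cp (q t : ℂ) (u : Fin n → ℕ) : ℂ :=
  ∏ i, ∏ j ∈ Finset.range (u i), (1 - q ^ (u i - j) * t ^ leg u i j)

/-- `M` is a family of interpolation Macdonald polynomials: `M u` has total degree
at most `|u|`, the coefficient of `x^u` in `M u` is `q^{−n'(u)}`, and `M u`
vanishes at `⟨v⟩` for every `v` with `|v| ≤ |u|`, `v ≠ u`. -/
def IsInterpFamily (q t : ℂ) (M : (Fin n → ℕ) → MvPolynomial (Fin n) ℂ) : Prop :=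
  ∀ u, (M u).totalDegree ≤ wt u ∧
    coeff (Finsupp.equivFunOnFinite.symm u) (M u) = (q ^ nstat' u)⁻¹ ∧
    ∀ v, wt v ≤ wt u → v ≠ u → eval (spec q t v) (M u) = 0

/-- `𝖬_u = q^{n'(u)} t^{n(u)} M_u / c'_u`. -/
def MM (q t : ℂ) (M : (Fin n → ℕ) → MvPolynomial (Fin n) ℂ) (u : Fin n → ℕ) :
    MvPolynomial (Fin n) ℂ :=
  C (q ^ nstat' u * t ^ nstat u / cp q t u) * M u

/-- `𝖤_u = t^{n(u)} E_u / c'_u`, where `E_u` is the homogeneous component of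
degree `|u|` of `M_u`. -/
def EE (q t : ℂ) (M : (Fin n → ℕ) → MvPolynomial (Fin n) ℂ) (u : Fin n → ℕ) :
    MvPolynomial (Fin n) ℂ :=
  C (t ^ nstat u / cp q t u) * homogeneousComponent (wt u) (M u)

/-- The generalized q-binomial coefficient `[u; v] = 𝖬_v(⟨u⟩)/𝖬_v(⟨v⟩)`. -/
def qbin (q t : ℂ) (M : (Fin n → ℕ) → MvPolynomial (Fin n) ℂ) (u v : Fin n → ℕ) : ℂ :=
  eval (spec q t u) (MM q t M v) / eval (spec q t v) (MM q t M v)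

/-- `⟨0⟩/a = (t^{n−1}/a, …, t/a, 1/a)`. -/
def spec0div (q t a : ℂ) : Fin n → ℂ := fun i => spec q t (fun _ => 0) i / a

/-- `cc` is the family of connection coefficients `c_{uv}(a,b)`:
`cc u v = 0` unless `|v| ≤ |u|`, and `𝖬_u(a·x) = Σ_v cc u v · 𝖬_v(b·x)`. -/
def IsConnection (q t : ℂ) (M : (Fin n → ℕ) → MvPolynomial (Fin n) ℂ) (a b : ℂ)
    (cc : (Fin n → ℕ) → (Fin n → ℕ) → ℂ) : Prop :=
  (∀ u v, wt u < wt v → cc u v = 0) ∧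
  ∀ u, aeval (fun i => C a * X i) (MM q t M u) =
    ∑ᶠ v, cc u v • aeval (fun i => C b * X i) (MM q t M v)

/-- `⟦u, v⟧(a, b) = (𝖤_v(⟨0⟩/a)/𝖤_u(⟨0⟩/b)) · c_{uv}(a, b)`. -/
def skew (q t : ℂ) (M : (Fin n → ℕ) → MvPolynomial (Fin n) ℂ) (a b : ℂ)
    (cc : (Fin n → ℕ) → (Fin n → ℕ) → ℂ) (u v : Fin n → ℕ) : ℂ :=
  eval (spec0div q t a) (EE q t M v) / eval (spec0div q t b) (EE q t M u) * cc u v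

/-- `(z; q)_∞ = ∏_{m ≥ 0} (1 − z q^m)`. -/
noncomputable def qpochInf (z q : ℂ) : ℂ := ∏' m : ℕ, (1 - z * q ^ m)

/-- The parameters `q`, `t` are nonzero and multiplicatively independent. -/
structure Generic (q t : ℂ) : Prop where
  q_ne : q ≠ 0
  t_ne : t ≠ 0
  ne_one : ∀ i j : ℤ, ¬(i = 0 ∧ j = 0) → q ^ i * t ^ j ≠ 1

lemma Generic.inv {q t : ℂ} (h : Generic q t) : Generic q⁻¹ t⁻¹ :=
  ⟨inv_ne_zero h.q_ne, inv_ne_zero h.t_ne, fun i j hij => by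
    have := h.ne_one (-i) (-j) (by omega)
    simpa [zpow_neg, inv_zpow] using this⟩

lemma Generic.monomial_ne {q t : ℂ} (h : Generic q t) {a b c d : ℕ} (hne : a ≠ b ∨ c ≠ d) :
    q ^ a * t ^ c ≠ q ^ b * t ^ d := by
  intro he
  have hq := h.q_ne
  have ht := h.t_ne
  refine h.ne_one ((a : ℤ) - b) ((c : ℤ) - d) (by omega) ?_
  rw [zpow_sub₀ hq, zpow_sub₀ ht]
  simp only [zpow_natCast]
  field_simp
  linear_combination he

/-- `(u_1, …, u_n) ↦ (u_2, …, u_n, u_1 + 1)`. -/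
def rot {m : ℕ} (u : Fin (m + 1) → ℕ) : Fin (m + 1) → ℕ :=
  Fin.snoc (Fin.tail u) (u 0 + 1)

/-- `(u_1, …, u_n) ↦ (u_n - 1, u_1, …, u_{n-1})`, with truncated subtraction. -/
def unrot {m : ℕ} (u : Fin (m + 1) → ℕ) : Fin (m + 1) → ℕ :=
  Fin.cons (u (Fin.last m) - 1) (Fin.init u)

/-- The adjacent transposition exchanging the positions `i` and `i + 1`. -/
def adj {m : ℕ} (i : Fin m) : Equiv.Perm (Fin (m + 1)) := Equiv.swap i.castSucc i.succ

section Combinatorics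

variable {m : ℕ}

lemma unrot_rot (u : Fin (m + 1) → ℕ) : unrot (rot u) = u := by
  simp [unrot, rot, Fin.init_snoc]

lemma rot_unrot {u : Fin (m + 1) → ℕ} (hu : u (Fin.last m) ≠ 0) : rot (unrot u) = u := by
  rw [rot, unrot, Fin.tail_cons, Fin.cons_zero, Nat.sub_add_cancel (Nat.pos_of_ne_zero hu),
    Fin.snoc_init_self]

lemma comp_adj_adj {α : Type*} (x : Fin (m + 1) → α) (i : Fin m) : (x ∘ adj i) ∘ adj i = x := by
  funext k
  simp [adj]

lemma comp_adj_castSucc {α : Type*} (x : Fin (m + 1) → α) (i : Fin m) :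
    (x ∘ adj i) i.castSucc = x i.succ := by
  simp [adj]

lemma comp_adj_succ {α : Type*} (x : Fin (m + 1) → α) (i : Fin m) :
    (x ∘ adj i) i.succ = x i.castSucc := by
  simp [adj]

lemma wt_rot (u : Fin (m + 1) → ℕ) : wt (rot u) = wt u + 1 := by
  rw [wt, wt, Fin.sum_univ_castSucc, Fin.sum_univ_succ]
  simp [rot, Fin.tail]
  ring

lemma wt_comp (u : Fin n → ℕ) (σ : Equiv.Perm (Fin n)) : wt (u ∘ σ) = wt u :=
  Equiv.sum_comp σ u

lemma wt_eq_zero {u : Fin n → ℕ} : wt u = 0 ↔ u = 0 := by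
  simp [wt, funext_iff]

/-- Every composition is reached from `0` by `rot` and exchanges of distinct neighbours. -/
lemma composition_induction {P : (Fin (m + 1) → ℕ) → Prop} (h0 : P 0)
    (hrot : ∀ v, P v → P (rot v))
    (hadj : ∀ v (i : Fin m), v i.castSucc ≠ v i.succ → P v → P (v ∘ adj i)) (u) : P u := by
  induction hd : wt u using Nat.strong_induction_on generalizing u with
  | _ d ih =>
    have key : ∀ (k : Fin (m + 1)) (u : Fin (m + 1) → ℕ), wt u = d → u k ≠ 0 → P u := by
      intro k
      induction k using Fin.reverseInduction with
      | last =>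
        intro u hu hk
        rw [← rot_unrot hk] at hu ⊢
        rw [wt_rot] at hu
        exact hrot _ (ih _ (by omega) _ rfl)
      | cast i IH =>
        intro u hu hk
        by_cases he : u i.castSucc = u i.succ
        · exact IH u hu (he ▸ hk)
        · rw [← comp_adj_adj u i]
          apply hadj
          · rw [comp_adj_castSucc, comp_adj_succ]
            exact Ne.symm he
          · refine IH _ (by rw [wt_comp, hu]) ?_
            rwa [comp_adj_succ]
    by_cases hu : u = 0
    · exact hu ▸ h0
    · obtain ⟨k, hk⟩ := Function.ne_iff.1 hu
      exact key k u hd hk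

lemma lp_eq_card (u : Fin n → ℕ) (i : Fin n) :
    lp u i = (Finset.univ.filter fun k => u i < u k ∨ (u i = u k ∧ k < i)).card := by
  rw [lp, ← Finset.card_union_of_disjoint]
  · congr 1
    ext k
    simp only [Finset.mem_union, Finset.mem_filter, Finset.mem_univ, true_and]
    rcases lt_trichotomy k i with h | rfl | h
    · simp [h, h.not_gt, le_iff_lt_or_eq]
    · simp
    · simp [h, h.not_gt]
  · rw [Finset.disjoint_filter]
    intro k _ h h'
    exact absurd h.1 h'.1.not_gt

lemma lp_le (u : Fin (m + 1) → ℕ) (i : Fin (m + 1)) : lp u i ≤ m := by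
  rw [lp_eq_card]
  have : (Finset.univ.filter fun k => u i < u k ∨ (u i = u k ∧ k < i)) ⊆ Finset.univ.erase i := by
    intro k hk
    have := (Finset.mem_filter.1 hk).2
    simp only [Finset.mem_erase, Finset.mem_univ, and_true]
    rintro rfl
    simp at this
  simpa using Finset.card_le_card this

lemma lp_last {u : Fin (m + 1) → ℕ} (hu : u (Fin.last m) = 0) : lp u (Fin.last m) = m := by
  rw [lp_eq_card]
  have : (Finset.univ.filter fun k => u (Fin.last m) < u k ∨
      (u (Fin.last m) = u k ∧ k < Fin.last m)) = Finset.univ.erase (Fin.last m) := by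
    ext k
    simp only [Finset.mem_erase, Finset.mem_univ, and_true, Finset.mem_filter, true_and, hu]
    constructor
    · rintro h rfl
      simp [hu] at h
    · intro h
      have := Fin.lt_last_iff_ne_last.2 h
      simp only [this, and_true]
      omega
  simp [this]

lemma lp_comp_adj {u : Fin (m + 1) → ℕ} {i : Fin m} (hu : u i.castSucc ≠ u i.succ)
    (k : Fin (m + 1)) : lp (u ∘ adj i) k = lp u (adj i k) := by
  rw [lp_eq_card, lp_eq_card]
  refine Finset.card_equiv (adj i) fun j => ?_
  simp only [Finset.mem_filter, Finset.mem_univ, true_and, Function.comp]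
  refine or_congr_right (and_congr_right fun h => ?_)
  simp only [adj, Equiv.swap_apply_def] at h ⊢
  split_ifs at h ⊢ <;>
    first
    | exact absurd h hu
    | exact absurd h.symm hu
    | (simp only [Fin.lt_def, Fin.ext_iff, Fin.val_succ, Fin.val_castSucc] at * <;> omega)

lemma lp_succ {u : Fin (m + 1) → ℕ} {i : Fin m} (hu : u i.castSucc = u i.succ) :
    lp u i.succ = lp u i.castSucc + 1 := by
  rw [lp_eq_card, lp_eq_card, ← Finset.card_insert_of_notMem (a := i.castSucc) (by simp)]
  congr 1
  ext k
  simp only [Finset.mem_filter, Finset.mem_insert, Finset.mem_univ, true_and, hu]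
  rcases eq_or_ne k i.castSucc with rfl | hk
  · simp [hu]
  · have : k < i.succ ↔ k < i.castSucc := by
      simp only [Fin.lt_def, Fin.val_succ, Fin.val_castSucc, ne_eq, Fin.ext_iff] at hk ⊢
      omega
    simp [hk, this]

lemma lp_rot_last (u : Fin (m + 1) → ℕ) : lp (rot u) (Fin.last m) = lp u 0 := by
  rw [lp_eq_card, lp_eq_card]
  simp only [Finset.card_filter]
  rw [Fin.sum_univ_castSucc, Fin.sum_univ_succ]
  simp only [rot, Fin.snoc_castSucc, Fin.snoc_last, Fin.tail, Fin.castSucc_lt_last, and_true,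
    lt_self_iff_false, and_false, or_false, if_false, add_zero, zero_add, Fin.not_lt_zero]
  refine Finset.sum_congr rfl fun k _ => ?_
  congr 1
  simp only [eq_iff_iff]
  omega

lemma lp_rot_castSucc (u : Fin (m + 1) → ℕ) (i : Fin m) :
    lp (rot u) i.castSucc = lp u i.succ := by
  rw [lp_eq_card, lp_eq_card]
  simp only [Finset.card_filter]
  rw [Fin.sum_univ_castSucc, Fin.sum_univ_succ, add_comm]
  simp only [rot, Fin.snoc_castSucc, Fin.snoc_last, Fin.tail, Fin.castSucc_lt_castSucc_iff,
    Fin.succ_lt_succ_iff, Fin.succ_pos, and_true, (Fin.castSucc_lt_last i).not_gt, and_false,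
    or_false]
  congr 2
  simp only [eq_iff_iff]
  omega

lemma two_mul_nplus_add_wt (u : Fin n → ℕ) :
    2 * nplus u + wt u = ∑ i, ∑ j, min (u i) (u j) := by
  have h : nplus u = ∑ i, ∑ j, if j < i then min (u i) (u j) else 0 := by
    rw [nplus, Finset.sum_comm]
    simp only [min_comm]
  have hw : wt u = ∑ i, ∑ j, if i = j then min (u i) (u j) else 0 := by
    simp [wt]
  rw [two_mul]
  nth_rewrite 2 [h]
  rw [hw, nplus, ← Finset.sum_add_distrib, ← Finset.sum_add_distrib]
  refine Finset.sum_congr rfl fun i _ => ?_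
  rw [← Finset.sum_add_distrib, ← Finset.sum_add_distrib]
  refine Finset.sum_congr rfl fun j _ => ?_
  rcases lt_trichotomy i j with h | rfl | h
  · simp [h, h.not_gt, h.ne]
  · simp
  · simp [h, h.not_gt, h.ne']

lemma nplus_comp (u : Fin n → ℕ) (σ : Equiv.Perm (Fin n)) : nplus (u ∘ σ) = nplus u := by
  have h := two_mul_nplus_add_wt (u ∘ σ)
  rw [wt_comp] at h
  have h' := two_mul_nplus_add_wt u
  have : ∑ i, ∑ j, min ((u ∘ σ) i) ((u ∘ σ) j) = ∑ i, ∑ j, min (u i) (u j) := by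
    rw [← Equiv.sum_comp σ fun i => ∑ j, min (u i) (u j)]
    exact Finset.sum_congr rfl fun i _ => Equiv.sum_comp σ fun j => min (u (σ i)) (u j)
  omega

lemma nstat'_comp (u : Fin n → ℕ) (σ : Equiv.Perm (Fin n)) : nstat' (u ∘ σ) = nstat' u :=
  Equiv.sum_comp σ fun i => Nat.choose (u i) 2

lemma nstat'_rot (u : Fin (m + 1) → ℕ) : nstat' (rot u) = nstat' u + u 0 := by
  rw [nstat', nstat', Fin.sum_univ_castSucc, Fin.sum_univ_succ]
  simp [rot, Fin.tail, Nat.choose_succ_succ' (u 0) 1]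
  ring

lemma nplus_rot (u : Fin (m + 1) → ℕ) : nplus (rot u) = nplus u + lp u 0 := by
  have h := two_mul_nplus_add_wt (rot u)
  rw [wt_rot] at h
  have h' := two_mul_nplus_add_wt u
  have hl : lp u 0 = ∑ k : Fin m, if u 0 < u k.succ then 1 else 0 := by
    rw [lp_eq_card, Finset.card_filter, Fin.sum_univ_succ]
    simp
  have hmin : ∑ k : Fin m, min (u 0 + 1) (u k.succ) =
      ∑ k : Fin m, min (u 0) (u k.succ) + lp u 0 := by
    rw [hl, ← Finset.sum_add_distrib]
    refine Finset.sum_congr rfl fun k _ => ?_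
    split_ifs <;> omega
  simp only [Fin.sum_univ_castSucc (n := m), rot, Fin.snoc_castSucc, Fin.snoc_last, Fin.tail,
    Finset.sum_add_distrib, min_self] at h
  simp only [Fin.sum_univ_succ (n := m), Finset.sum_add_distrib, min_self] at h'
  simp only [min_comm (u (Fin.succ _)) (u 0 + 1), min_comm (u (Fin.succ _)) (u 0)] at h h'
  simp only [rot]
  omega

end Combinatorics

section Spectral

variable {m : ℕ} {q t : ℂ}

lemma spec_apply (u : Fin (m + 1) → ℕ) (i : Fin (m + 1)) :
    spec q t u i = q ^ u i * t ^ (m - lp u i) := rfl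

lemma spec_ne_zero (h : Generic q t) (u : Fin n → ℕ) (i : Fin n) : spec q t u i ≠ 0 :=
  mul_ne_zero (pow_ne_zero _ h.q_ne) (pow_ne_zero _ h.t_ne)

lemma spec_inv (u : Fin n → ℕ) (i : Fin n) : spec q⁻¹ t⁻¹ u i = (spec q t u i)⁻¹ := by
  simp [spec, mul_comm]

lemma spec_last_of_eq_zero {u : Fin (m + 1) → ℕ} (hu : u (Fin.last m) = 0) :
    spec q t u (Fin.last m) = 1 := by
  simp [spec_apply, hu, lp_last hu]

lemma spec_last_ne_one (h : Generic q t) {u : Fin (m + 1) → ℕ} (hu : u (Fin.last m) ≠ 0) :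
    spec q t u (Fin.last m) ≠ 1 := by
  rw [spec_apply]
  simpa using h.monomial_ne (b := 0) (c := m - lp u (Fin.last m)) (d := 0) (Or.inl hu)

lemma spec_rot_last (u : Fin (m + 1) → ℕ) :
    spec q t (rot u) (Fin.last m) = q * spec q t u 0 := by
  rw [spec_apply, spec_apply, lp_rot_last, rot, Fin.snoc_last]
  ring

lemma spec_rot_castSucc (u : Fin (m + 1) → ℕ) (i : Fin m) :
    spec q t (rot u) i.castSucc = spec q t u i.succ := by
  rw [spec_apply, spec_apply, lp_rot_castSucc, rot, Fin.snoc_castSucc, Fin.tail]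

lemma spec_rot_last_ne_one (h : Generic q t) (u : Fin (m + 1) → ℕ) :
    spec q t (rot u) (Fin.last m) ≠ 1 :=
  spec_last_ne_one h (by simp [rot])

lemma spec_unrot (h : Generic q t) {u : Fin (m + 1) → ℕ} (hu : u (Fin.last m) ≠ 0) :
    spec q t (unrot u) =
      Fin.cons (q⁻¹ * spec q t u (Fin.last m)) fun i => spec q t u i.castSucc := by
  have hq := h.q_ne
  rw [← rot_unrot hu, unrot_rot]
  funext k
  refine Fin.cases ?_ (fun i => ?_) k
  · rw [Fin.cons_zero, spec_rot_last]
    field_simp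
  · rw [Fin.cons_succ, spec_rot_castSucc]

lemma spec_comp_adj {u : Fin (m + 1) → ℕ} {i : Fin m} (hu : u i.castSucc ≠ u i.succ) :
    spec q t (u ∘ adj i) = spec q t u ∘ adj i := by
  funext k
  simp only [Function.comp, spec_apply]
  rw [← lp_comp_adj hu, Function.comp_def]

lemma spec_castSucc_of_eq {u : Fin (m + 1) → ℕ} {i : Fin m} (hu : u i.castSucc = u i.succ) :
    spec q t u i.castSucc = t * spec q t u i.succ := by
  have h := lp_le u i.succ
  rw [lp_succ hu] at h
  rw [spec_apply, spec_apply, lp_succ hu, hu,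
    show m - lp u i.castSucc = m - (lp u i.castSucc + 1) + 1 by omega, pow_succ]
  ring

lemma spec_castSucc_ne_succ (h : Generic q t) (u : Fin (m + 1) → ℕ) (i : Fin m) :
    spec q t u i.castSucc ≠ spec q t u i.succ := by
  rw [spec_apply, spec_apply]
  refine h.monomial_ne ?_
  by_cases hu : u i.castSucc = u i.succ
  · have := lp_le u i.succ
    rw [lp_succ hu] at this ⊢
    omega
  · exact Or.inl hu

lemma spec_castSucc_ne_mul (h : Generic q t) {u : Fin (m + 1) → ℕ} {i : Fin m}
    (hu : u i.castSucc ≠ u i.succ) : spec q t u i.castSucc ≠ t * spec q t u i.succ := by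
  rw [spec_apply, spec_apply, show t * (q ^ u i.succ * t ^ (m - lp u i.succ)) =
    q ^ u i.succ * t ^ (m - lp u i.succ + 1) by ring]
  exact h.monomial_ne (Or.inl hu)

lemma tau_ne_zero (h : Generic q t) (u : Fin n → ℕ) : tau q t u ≠ 0 := by
  simp [tau, h.q_ne, h.t_ne]

lemma tau_zero : tau q t (0 : Fin n → ℕ) = 1 := by
  simp [tau, wt, nstat', nplus]

lemma tau_comp (u : Fin n → ℕ) (σ : Equiv.Perm (Fin n)) : tau q t (u ∘ σ) = tau q t u := by
  rw [tau, tau, wt_comp, nstat'_comp, nplus_comp]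

lemma tau_rot (h : Generic q t) (u : Fin (m + 1) → ℕ) :
    tau q t (rot u) = -(t ^ m)⁻¹ * spec q t u 0 * tau q t u := by
  have ht := h.t_ne
  rw [tau, tau, wt_rot, nstat'_rot, nplus_rot, spec_apply]
  have : t ^ m = t ^ (m - lp u 0) * t ^ lp u 0 := by
    rw [← pow_add, Nat.sub_add_cancel (lp_le u 0)]
  rw [this]
  field_simp
  ring

end Spectral

section Operators

variable {m : ℕ} {q t : ℂ}

/-- Functions on compositions with `m + 1` parts. -/
abbrev CompFun (m : ℕ) := (Fin (m + 1) → ℕ) → ℂ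

/-- The coefficient `(x_i - t x_{i+1}) / (x_i - x_{i+1})` at the spectral vector of `u`. -/
def heckeCoeff (q t : ℂ) (i : Fin m) (u : Fin (m + 1) → ℕ) : ℂ :=
  (spec q t u i.castSucc - t * spec q t u i.succ) / (spec q t u i.castSucc - spec q t u i.succ)

/-- The action on values at spectral vectors of `(x_i - t x_{i+1}) / (x_i - x_{i+1}) (s_i - 1)`. -/
def hecke (q t : ℂ) (i : Fin m) : CompFun m →ₗ[ℂ] CompFun m where
  toFun f u := heckeCoeff q t i u * (f (u ∘ adj i) - f u)
  map_add' f g := by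
    funext u
    simp only [Pi.add_apply]
    ring
  map_smul' c f := by
    funext u
    simp only [Pi.smul_apply, smul_eq_mul, RingHom.id_apply]
    ring

/-- The action on values at spectral vectors of
`f(x) ↦ (x_n - 1) f(x_n / q, x_1, …, x_{n-1})`. -/
def raise (q t : ℂ) : CompFun m →ₗ[ℂ] CompFun m where
  toFun f u := (spec q t u (Fin.last m) - 1) * f (unrot u)
  map_add' f g := by
    funext u
    simp only [Pi.add_apply]
    ring
  map_smul' c f := by
    funext u
    simp only [Pi.smul_apply, smul_eq_mul, RingHom.id_apply]
    ring

lemma hecke_apply (i : Fin m) (f : CompFun m) (u : Fin (m + 1) → ℕ) :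
    hecke q t i f u = heckeCoeff q t i u * (f (u ∘ adj i) - f u) := rfl

lemma raise_apply (f : CompFun m) (u : Fin (m + 1) → ℕ) :
    raise q t f u = (spec q t u (Fin.last m) - 1) * f (unrot u) := rfl

lemma heckeCoeff_ne_zero (h : Generic q t) {u : Fin (m + 1) → ℕ} {i : Fin m}
    (hu : u i.castSucc ≠ u i.succ) : heckeCoeff q t i u ≠ 0 :=
  div_ne_zero (sub_ne_zero.2 (spec_castSucc_ne_mul h hu))
    (sub_ne_zero.2 (spec_castSucc_ne_succ h u i))

lemma heckeCoeff_inv (h : Generic q t) (i : Fin m) (u : Fin (m + 1) → ℕ) :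
    heckeCoeff q⁻¹ t⁻¹ i u = t⁻¹ * heckeCoeff q t i u := by
  have ht := h.t_ne
  have h1 := spec_ne_zero h u i.castSucc
  have h2 := spec_ne_zero h u i.succ
  have h3 := sub_ne_zero.2 (spec_castSucc_ne_succ h u i)
  have h4 := sub_ne_zero.2 (spec_castSucc_ne_succ h u i).symm
  rw [heckeCoeff, heckeCoeff, spec_inv, spec_inv]
  generalize spec q t u i.castSucc = x at *
  generalize spec q t u i.succ = y at *
  have h5 : x⁻¹ - y⁻¹ ≠ 0 := by
    rw [inv_sub_inv h1 h2]
    exact div_ne_zero h4 (mul_ne_zero h1 h2)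
  rw [← mul_div_assoc, div_eq_div_iff h5 h3]
  field_simp
  ring

lemma raise_eq_zero (f : CompFun m) {u : Fin (m + 1) → ℕ} (hu : u (Fin.last m) = 0) :
    raise q t f u = 0 := by
  rw [raise_apply, spec_last_of_eq_zero hu, sub_self, zero_mul]

lemma raise_rot (f : CompFun m) (u : Fin (m + 1) → ℕ) :
    raise q t f (rot u) = (spec q t (rot u) (Fin.last m) - 1) * f u := by
  rw [raise_apply, unrot_rot]

lemma raise_single (u : Fin (m + 1) → ℕ) :
    raise q t (Pi.single u 1) =
      (spec q t (rot u) (Fin.last m) - 1) • Pi.single (rot u) (1 : ℂ) := by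
  funext v
  by_cases hv : v (Fin.last m) = 0
  · rw [raise_eq_zero _ hv, Pi.smul_apply, Pi.single_eq_of_ne, smul_zero]
    rintro rfl
    simp [rot] at hv
  · rw [← rot_unrot hv, raise_rot]
    by_cases hvu : unrot v = u
    · subst hvu
      simp
    · rw [Pi.single_eq_of_ne hvu, Pi.smul_apply, Pi.single_eq_of_ne, mul_zero, smul_zero]
      intro he
      exact hvu (by rw [← unrot_rot (unrot v), he, unrot_rot])

lemma hecke_single_apply (i : Fin m) (u v : Fin (m + 1) → ℕ) (hv : wt v ≠ wt u) :
    hecke q t i (Pi.single u 1) v = 0 := by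
  rw [hecke_apply, Pi.single_eq_of_ne, Pi.single_eq_of_ne, sub_zero, mul_zero]
  · rintro rfl
    exact hv rfl
  · rintro rfl
    exact hv (wt_comp _ _).symm

lemma hecke_add_single {i : Fin m} {u : Fin (m + 1) → ℕ} (hu : u i.castSucc ≠ u i.succ) :
    hecke q t i (Pi.single u 1) + heckeCoeff q t i u • Pi.single u 1 =
      heckeCoeff q t i (u ∘ adj i) • Pi.single (u ∘ adj i) (1 : ℂ) := by
  have hne : u ∘ adj i ≠ u := by
    intro he
    have := congrFun he i.succ
    rw [comp_adj_succ] at this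
    exact hu this
  funext v
  simp only [Pi.add_apply, Pi.smul_apply, smul_eq_mul, hecke_apply]
  by_cases h1 : v = u
  · subst h1
    simp [Pi.single_eq_of_ne hne, Pi.single_eq_of_ne hne.symm]
  · by_cases h2 : v = u ∘ adj i
    · subst h2
      simp [comp_adj_adj, Pi.single_eq_of_ne hne]
    · have h3 : v ∘ adj i ≠ u := by
        rintro rfl
        exact h2 (comp_adj_adj _ _).symm
      simp [Pi.single_eq_of_ne h1, Pi.single_eq_of_ne h2, Pi.single_eq_of_ne h3]

/-- A function killed by `hecke q t i` is invariant under the exchange of the parts `i`, `i + 1`. -/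
lemma comp_adj_eq_of_hecke_eq_zero (h : Generic q t) {g : CompFun m} {i : Fin m}
    (hg : hecke q t i g = 0) (u : Fin (m + 1) → ℕ) (hu : u i.castSucc ≠ u i.succ) :
    g (u ∘ adj i) = g u := by
  have := congrFun hg u
  rw [hecke_apply, Pi.zero_apply, mul_eq_zero, or_iff_right (heckeCoeff_ne_zero h hu)] at this
  exact sub_eq_zero.1 this

lemma hecke_inv (h : Generic q t) (i : Fin m) (f : CompFun m) :
    hecke q⁻¹ t⁻¹ i f = t⁻¹ • hecke q t i f := by
  funext u
  rw [Pi.smul_apply, hecke_apply, hecke_apply, heckeCoeff_inv h, smul_eq_mul, mul_assoc]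

lemma raise_tau (h : Generic q t) (u : Fin (m + 1) → ℕ) :
    raise q t (tau q t) u = q * t ^ m * ((spec q t u (Fin.last m))⁻¹ - 1) * tau q t u := by
  have hs := spec_ne_zero h u (Fin.last m)
  by_cases hu : u (Fin.last m) = 0
  · rw [raise_eq_zero _ hu, spec_last_of_eq_zero hu]
    simp
  · rw [← rot_unrot hu] at hs ⊢
    rw [raise_rot, tau_rot h]
    rw [spec_rot_last] at hs ⊢
    have ht := h.t_ne
    have hq := h.q_ne
    have h0 := right_ne_zero_of_mul hs
    field_simp
    ring

lemma raise_mul_tau (h : Generic q t) (f : CompFun m) :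
    raise q t (tau q t * f) = (q * t ^ m) • (tau q t * raise q⁻¹ t⁻¹ f) := by
  have hs := fun u : Fin (m + 1) → ℕ => spec_ne_zero h u (Fin.last m)
  funext u
  have := raise_tau h u
  rw [raise_apply] at this
  rw [raise_apply, Pi.mul_apply, ← mul_assoc, this, Pi.smul_apply, Pi.mul_apply, raise_apply,
    spec_inv, smul_eq_mul]
  ring

lemma hecke_mul_tau (i : Fin m) (f : CompFun m) :
    hecke q t i (tau q t * f) = tau q t * hecke q t i f := by
  funext u
  simp only [hecke_apply, Pi.mul_apply, tau_comp]
  ring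

end Operators

section Polynomials

variable {m : ℕ} {q t : ℂ}

lemma dvd_algHom_apply_sub {σ R : Type*} [CommRing R]
    {f : MvPolynomial σ R →ₐ[R] MvPolynomial σ R} {g : MvPolynomial σ R}
    (hg : ∀ i, g ∣ f (X i) - X i) (P : MvPolynomial σ R) : g ∣ f P - P := by
  induction P using MvPolynomial.induction_on with
  | C a => simp [← algebraMap_eq]
  | add P Q hP hQ =>
    rw [map_add, add_sub_add_comm]
    exact dvd_add hP hQ
  | mul_X P i hP =>
    rw [map_mul, show f P * f (X i) - P * X i = f P * (f (X i) - X i) + (f P - P) * X i by ring]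
    exact dvd_add (dvd_mul_of_dvd_right (hg i) _) (dvd_mul_of_dvd_left hP _)

lemma totalDegree_aeval_le {σ τ R : Type*} [CommSemiring R] {f : σ → MvPolynomial τ R}
    (hf : ∀ i, (f i).totalDegree ≤ 1) (P : MvPolynomial σ R) :
    (aeval f P).totalDegree ≤ P.totalDegree := by
  rw [aeval_def, eval₂_eq]
  refine totalDegree_finsetSum_le fun d hd => ?_
  refine (totalDegree_mul _ _).trans ?_
  rw [algebraMap_eq, totalDegree_C, zero_add]
  refine ((totalDegree_finsetProd _ _).trans (Finset.sum_le_sum fun i _ => ?_)).trans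
    (le_totalDegree hd)
  exact (totalDegree_pow _ _).trans ((Nat.mul_le_mul_left _ (hf i)).trans (mul_one _).le)

lemma totalDegree_le_of_mul_eq {σ R : Type*} [CommRing R] [IsDomain R]
    {P Q L : MvPolynomial σ R} {d : ℕ} (hL : L.IsHomogeneous 1) (hL0 : L ≠ 0)
    (h : L * Q = P) (hP : P.totalDegree ≤ d + 1) : Q.totalDegree ≤ d := by
  by_cases hQ : Q = 0
  · simp [hQ]
  · rw [← h, totalDegree_mul_of_isDomain hL0 hQ, hL.totalDegree hL0] at hP
    omega

/-- The values of a polynomial at the spectral vectors. -/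
def specEval (q t : ℂ) : MvPolynomial (Fin (m + 1)) ℂ →ₗ[ℂ] CompFun m where
  toFun P u := eval (spec q t u) P
  map_add' P Q := by
    funext u
    simp
  map_smul' c P := by
    funext u
    simp

lemma specEval_apply (P : MvPolynomial (Fin (m + 1)) ℂ) (u : Fin (m + 1) → ℕ) :
    specEval q t P u = eval (spec q t u) P := rfl

lemma exists_hecke_mul (t : ℂ) (i : Fin m) (P : MvPolynomial (Fin (m + 1)) ℂ) :
    ∃ Q : MvPolynomial (Fin (m + 1)) ℂ, Q.totalDegree ≤ P.totalDegree ∧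
      (X i.castSucc - X i.succ) * Q =
        (X i.castSucc - C t * X i.succ) * (rename (adj i) P - P) := by
  obtain ⟨R, hR⟩ : (X i.castSucc - X i.succ : MvPolynomial (Fin (m + 1)) ℂ) ∣
      rename (adj i) P - P := by
    refine dvd_algHom_apply_sub (f := rename (adj i)) (fun k => ?_) P
    rw [rename_X, adj, Equiv.swap_apply_def]
    split_ifs with h1 h2
    · subst h1
      exact ⟨-1, by ring⟩
    · subst h2
      exact dvd_rfl
    · simp
  refine ⟨(X i.castSucc - C t * X i.succ) * R, ?_, by rw [hR]; ring⟩
  have hL : (X i.castSucc - X i.succ : MvPolynomial (Fin (m + 1)) ℂ).IsHomogeneous 1 :=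
    (isHomogeneous_X _ _).sub (isHomogeneous_X _ _)
  have hL0 : (X i.castSucc - X i.succ : MvPolynomial (Fin (m + 1)) ℂ) ≠ 0 :=
    sub_ne_zero.2 fun he => Fin.castSucc_lt_succ.ne (X_injective he)
  have hP : (rename (adj i) P - P).totalDegree ≤ P.totalDegree :=
    (totalDegree_sub _ _).trans (max_le (totalDegree_rename_le _ _) le_rfl)
  by_cases hR0 : R = 0
  · simp [hR0]
  · rw [hR, totalDegree_mul_of_isDomain hL0 hR0, hL.totalDegree hL0] at hP
    refine (totalDegree_mul _ _).trans (le_trans (Nat.add_le_add_right ?_ _) hP)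
    refine (totalDegree_sub _ _).trans (max_le (totalDegree_X _).le ?_)
    exact (totalDegree_mul _ _).trans (by simp)

lemma specEval_of_hecke_mul (h : Generic q t) {i : Fin m} {P Q : MvPolynomial (Fin (m + 1)) ℂ}
    (hQ : (X i.castSucc - X i.succ) * Q =
        (X i.castSucc - C t * X i.succ) * (rename (adj i) P - P)) :
    specEval q t Q = hecke q t i (specEval q t P) := by
  funext u
  have hne := sub_ne_zero.2 (spec_castSucc_ne_succ h u i)
  have := congrArg (eval (spec q t u)) hQ
  simp only [map_mul, map_sub, eval_X, eval_C, eval_rename] at this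
  rw [hecke_apply, specEval_apply, specEval_apply, specEval_apply, heckeCoeff, div_mul_eq_mul_div,
    eq_div_iff hne, mul_comm, this]
  by_cases hu : u i.castSucc = u i.succ
  · rw [spec_castSucc_of_eq hu]
    ring
  · rw [spec_comp_adj hu]

lemma exists_hecke (h : Generic q t) (i : Fin m) (P : MvPolynomial (Fin (m + 1)) ℂ) :
    ∃ Q : MvPolynomial (Fin (m + 1)) ℂ, Q.totalDegree ≤ P.totalDegree ∧
      specEval q t Q = hecke q t i (specEval q t P) := by
  obtain ⟨Q, hQ, hQP⟩ := exists_hecke_mul t i P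
  exact ⟨Q, hQ, specEval_of_hecke_mul h hQP⟩

/-- The polynomial `(x_n - 1) P(x_n / q, x_1, …, x_{n-1})`. -/
def raisePoly (q : ℂ) (P : MvPolynomial (Fin (m + 1)) ℂ) : MvPolynomial (Fin (m + 1)) ℂ :=
  (X (Fin.last m) - 1) *
    aeval (Fin.cons (C q⁻¹ * X (Fin.last m)) fun i : Fin m => X i.castSucc) P

lemma totalDegree_raisePoly (q : ℂ) (P : MvPolynomial (Fin (m + 1)) ℂ) :
    (raisePoly q P).totalDegree ≤ P.totalDegree + 1 := by
  rw [add_comm P.totalDegree]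
  refine (totalDegree_mul _ _).trans (Nat.add_le_add ?_ (totalDegree_aeval_le (fun k => ?_) P))
  · exact (totalDegree_sub _ _).trans (by simp)
  · refine Fin.cases ?_ (fun i => ?_) k
    · exact (totalDegree_mul _ _).trans (by simp)
    · simp

lemma specEval_raisePoly (h : Generic q t) (P : MvPolynomial (Fin (m + 1)) ℂ) :
    specEval q t (raisePoly q P) = raise q t (specEval q t P) := by
  funext u
  by_cases hu : u (Fin.last m) = 0
  · rw [raise_eq_zero _ hu, specEval_apply, raisePoly, map_mul, map_sub, eval_X, map_one,
      spec_last_of_eq_zero hu, sub_self, zero_mul]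
  · rw [raise_apply, specEval_apply, specEval_apply, spec_unrot h hu, raisePoly, map_mul, map_sub,
      eval_X, map_one]
    congr 1
    have : (eval (spec q t u)).comp (aeval (Fin.cons (C q⁻¹ * X (Fin.last m))
          fun i : Fin m => X i.castSucc)).toRingHom =
        eval (Fin.cons (q⁻¹ * spec q t u (Fin.last m)) fun i : Fin m => spec q t u i.castSucc) := by
      refine ringHom_ext (fun r => by simp [← algebraMap_eq]) fun k => ?_
      refine Fin.cases ?_ (fun i => ?_) k <;> simp
    exact congrArg (fun f => f P) this

/-- The variables of `m` letters, with a zero inserted at position `k`. -/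
def zeroAt (k : Fin (m + 1)) : Fin (m + 1) → MvPolynomial (Fin m) ℂ :=
  Fin.insertNth (α := fun _ => MvPolynomial (Fin m) ℂ) k 0 X

lemma zeroAt_self (k : Fin (m + 1)) : zeroAt k k = 0 :=
  Fin.insertNth_apply_same _ _ _

lemma zeroAt_succAbove (k : Fin (m + 1)) (i : Fin m) : zeroAt k (k.succAbove i) = X i :=
  Fin.insertNth_apply_succAbove _ _ _ _

lemma zeroAt_castSucc_comp_adj (i : Fin m) : zeroAt i.castSucc ∘ adj i = zeroAt i.succ := by
  funext k
  refine Fin.succAboveCases i.succ ?_ (fun j => ?_) k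
  · rw [comp_adj_succ, zeroAt_self, zeroAt_self]
  · have : adj i (i.succ.succAbove j) = i.castSucc.succAbove j := by
      simp only [adj, Equiv.swap_apply_def, Fin.succAbove, Fin.lt_def, Fin.ext_iff]
      split_ifs <;> simp_all <;> omega
    rw [zeroAt_succAbove, Function.comp, this, zeroAt_succAbove]

/-- The partial products of Hecke generators acting on values at spectral vectors. -/
lemma exists_hecke_chain (h : Generic q t) (k : Fin (m + 1)) :
    ∃ L : CompFun m →ₗ[ℂ] CompFun m,
      (∀ f d, (∀ u, wt u < d → f u = 0) → ∀ u, wt u < d → L f u = 0) ∧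
      (∀ g, (∀ i, hecke q t i g = 0) → L g = t ^ (m - k : ℕ) • g) ∧
      ∀ P : MvPolynomial (Fin (m + 1)) ℂ, ∃ Q : MvPolynomial (Fin (m + 1)) ℂ,
        Q.totalDegree ≤ P.totalDegree ∧ specEval q t Q = L (specEval q t P) ∧
        aeval (zeroAt k) Q = C (t ^ (m - k : ℕ)) * aeval (zeroAt (Fin.last m)) P := by
  induction k using Fin.reverseInduction with
  | last => exact ⟨LinearMap.id, fun f d hf => hf, by simp, fun P => ⟨P, le_rfl, rfl, by simp⟩⟩
  | cast i IH =>
    obtain ⟨L, hL, hsymm, hpoly⟩ := IH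
    have hexp : m - (i.castSucc : ℕ) = m - (i.succ : ℕ) + 1 := by
      simp only [Fin.val_castSucc, Fin.val_succ]
      omega
    refine ⟨(hecke q t i + t • LinearMap.id) ∘ₗ L, fun f d hf u hu => ?_, fun g hg => ?_,
      fun P => ?_⟩
    · have h1 := hL f d hf u hu
      have h2 := hL f d hf (u ∘ adj i) (by rwa [wt_comp])
      simp [hecke_apply, h1, h2]
    · rw [LinearMap.comp_apply, hsymm g hg, map_smul, LinearMap.add_apply, hg i, hexp, pow_succ,
        zero_add, LinearMap.smul_apply, LinearMap.id_apply, smul_smul]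
    · obtain ⟨Q, hQ, hQL, hQ0⟩ := hpoly P
      obtain ⟨R, hR, hRQ⟩ := exists_hecke_mul t i Q
      refine ⟨R + t • Q, ?_, ?_, ?_⟩
      · exact (totalDegree_add _ _).trans
          (max_le (hR.trans hQ) ((totalDegree_smul_le _ _).trans hQ))
      · rw [map_add, map_smul, specEval_of_hecke_mul h hRQ, hQL]
        rfl
      · have h0 := congrArg (aeval (zeroAt i.castSucc)) hRQ
        have hz : zeroAt i.castSucc i.succ = X i := by
          rw [← zeroAt_succAbove i.castSucc i, Fin.succAbove_castSucc_self]
        simp only [map_mul, map_sub, aeval_X, aeval_rename, zeroAt_castSucc_comp_adj, zeroAt_self,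
          hz, hQ0, algHom_C, algebraMap_eq] at h0
        have hX : (X i : MvPolynomial (Fin m) ℂ) ≠ 0 := X_ne_zero i
        rw [map_add, map_smul, smul_eq_C_mul, hexp, pow_succ, C_mul]
        apply mul_left_cancel₀ hX
        linear_combination -h0

/-- The Cherednik operator `x_n⁻¹ (1 + t^{1-n} Φ T_1 ⋯ T_{n-1})` acting on values at spectral
vectors. -/
lemma exists_cherednik (h : Generic q t) :
    ∃ Ξ : CompFun m →ₗ[ℂ] CompFun m,
      (∀ f d, (∀ u, wt u < d → f u = 0) → ∀ u, wt u ≤ d →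
        Ξ f u = (spec q t u (Fin.last m))⁻¹ * f u) ∧
      (∀ g, (∀ i, hecke q t i g = 0) → ∀ u,
        Ξ g u = (spec q t u (Fin.last m))⁻¹ * (g u + raise q t g u)) ∧
      ∀ P : MvPolynomial (Fin (m + 1)) ℂ, ∃ Q : MvPolynomial (Fin (m + 1)) ℂ,
        Q.totalDegree ≤ P.totalDegree ∧ specEval q t Q = Ξ (specEval q t P) := by
  obtain ⟨L, hL, hsymm, hpoly⟩ := exists_hecke_chain (m := m) h 0
  simp only [Fin.val_zero, Nat.sub_zero] at hsymm hpoly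
  have ht : t ^ m ≠ 0 := pow_ne_zero _ h.t_ne
  refine ⟨LinearMap.mulLeft ℂ (fun u => (spec q t u (Fin.last m))⁻¹) ∘ₗ
    (LinearMap.id + (t ^ m)⁻¹ • (raise q t ∘ₗ L)), fun f d hf u hu => ?_, fun g hg u => ?_,
    fun P => ?_⟩
  · have : raise q t (L f) u = 0 := by
      by_cases hu0 : u (Fin.last m) = 0
      · exact raise_eq_zero _ hu0
      · rw [← rot_unrot hu0, wt_rot] at hu
        rw [raise_apply, hL f d hf _ (by omega), mul_zero]
    simp [this]
  · simp [hsymm g hg, ht]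
  · obtain ⟨Q, hQ, hQL, hQ0⟩ := hpoly P
    set R := P + (t ^ m)⁻¹ • raisePoly q Q with hRdef
    have hRdeg : R.totalDegree ≤ P.totalDegree + 1 :=
      (totalDegree_add _ _).trans (max_le (Nat.le_succ _) ((totalDegree_smul_le _ _).trans
        ((totalDegree_raisePoly q Q).trans (Nat.add_le_add_right hQ 1))))
    have hcast (i : Fin m) : zeroAt (Fin.last m) i.castSucc = X i := by
      rw [← zeroAt_succAbove (Fin.last m) i, Fin.succAbove_last]
    have hR0 : aeval (zeroAt (Fin.last m)) R = 0 := by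
      have hshift : (aeval (zeroAt (Fin.last m))).comp (aeval (Fin.cons (C q⁻¹ * X (Fin.last m))
          fun i : Fin m => X i.castSucc)) = aeval (R := ℂ) (zeroAt (0 : Fin (m + 1))) := by
        refine algHom_ext fun k => ?_
        refine Fin.cases ?_ (fun i => ?_) k
        · simp [zeroAt_self]
        · simp [hcast, ← zeroAt_succAbove (0 : Fin (m + 1)) i]
      have := congrArg (fun f => f Q) hshift
      simp only [AlgHom.comp_apply] at this
      rw [hRdef, map_add, map_smul, raisePoly, map_mul, this, hQ0, map_sub, aeval_X, zeroAt_self,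
        map_one, smul_eq_C_mul]
      have hC : (C (t ^ m)⁻¹ * C (t ^ m) : MvPolynomial (Fin m) ℂ) = 1 := by
        rw [← C_mul, inv_mul_cancel₀ ht, C_1]
      linear_combination -(aeval (zeroAt (Fin.last m)) P) * hC
    obtain ⟨S, hS⟩ : X (Fin.last m) ∣ (rename Fin.castSucc).comp (aeval (zeroAt (Fin.last m))) R
        - R := by
      refine dvd_algHom_apply_sub (fun k => ?_) R
      refine Fin.lastCases ?_ (fun i => ?_) k
      · simp [zeroAt_self]
      · simp [hcast]
    rw [AlgHom.comp_apply, hR0, map_zero, zero_sub] at hS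
    refine ⟨-S, totalDegree_le_of_mul_eq (isHomogeneous_X ℂ (Fin.last m)) (X_ne_zero _)
      (P := R) (by rw [mul_neg, ← hS, neg_neg]) hRdeg, ?_⟩
    funext u
    have hs := spec_ne_zero h u (Fin.last m)
    have h1 := congrArg (fun P => specEval q t P u) hS
    simp only [hRdef, map_neg, map_add, map_smul, specEval_raisePoly h, hQL] at h1
    rw [specEval_apply _ u, map_mul, eval_X, ← specEval_apply] at h1
    simp only [map_neg, Pi.neg_apply, LinearMap.comp_apply, LinearMap.mulLeft_apply, Pi.mul_apply,
      LinearMap.add_apply, LinearMap.id_apply, LinearMap.smul_apply, Pi.add_apply, Pi.smul_apply]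
      at h1 ⊢
    rw [eq_inv_mul_iff_mul_eq₀ hs, mul_neg, ← h1, neg_neg]

end Polynomials

section Unisolvence

variable {m : ℕ} {q t : ℂ}

/-- The compositions of weight at most `d`. -/
def wtLE (n d : ℕ) : Finset (Fin n → ℕ) :=
  (Fintype.piFinset fun _ => Finset.range (d + 1)).filter fun u => wt u ≤ d

lemma mem_wtLE {d : ℕ} {u : Fin n → ℕ} : u ∈ wtLE n d ↔ wt u ≤ d := by
  simp only [wtLE, Finset.mem_filter, Fintype.mem_piFinset, Finset.mem_range, and_iff_right_iff_imp]
  intro h i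
  exact Nat.lt_succ_of_le ((Finset.single_le_sum (fun _ _ => Nat.zero_le _)
    (Finset.mem_univ i)).trans h)

lemma hecke_congr {f g : CompFun m} {d : ℕ} (hfg : ∀ u, wt u ≤ d → f u = g u) (i : Fin m)
    (u : Fin (m + 1) → ℕ) (hu : wt u ≤ d) : hecke q t i f u = hecke q t i g u := by
  rw [hecke_apply, hecke_apply, hfg u hu, hfg _ (by rwa [wt_comp])]

lemma raise_congr {f g : CompFun m} {d : ℕ} (hfg : ∀ u, wt u ≤ d → f u = g u)
    (u : Fin (m + 1) → ℕ) (hu : wt u ≤ d + 1) : raise q t f u = raise q t g u := by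
  by_cases hu0 : u (Fin.last m) = 0
  · rw [raise_eq_zero _ hu0, raise_eq_zero _ hu0]
  · rw [← rot_unrot hu0, wt_rot] at hu
    rw [raise_apply, raise_apply, hfg _ (by omega)]

lemma exists_newton (h : Generic q t) (v : Fin (m + 1) → ℕ) :
    ∃ P : MvPolynomial (Fin (m + 1)) ℂ, P.totalDegree ≤ wt v ∧
      ∀ u, wt u ≤ wt v → specEval q t P u = Pi.single (M := fun _ => ℂ) v 1 u := by
  induction v using composition_induction with
  | h0 =>
    refine ⟨1, by simp, fun u hu => ?_⟩
    rw [wt_eq_zero.2 rfl, Nat.le_zero, wt_eq_zero] at hu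
    subst hu
    simp [specEval_apply]
  | hrot v ih =>
    obtain ⟨P, hP, hPv⟩ := ih
    have hne := sub_ne_zero.2 (spec_rot_last_ne_one h v)
    refine ⟨(spec q t (rot v) (Fin.last m) - 1)⁻¹ • raisePoly q P, ?_, fun u hu => ?_⟩
    · rw [wt_rot]
      exact (totalDegree_smul_le _ _).trans
        ((totalDegree_raisePoly q P).trans (Nat.add_le_add_right hP 1))
    · rw [wt_rot] at hu
      rw [map_smul, Pi.smul_apply, specEval_raisePoly h, raise_congr hPv u hu, raise_single,
        Pi.smul_apply, smul_smul, inv_mul_cancel₀ hne, one_smul]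
  | hadj v i hv ih =>
    obtain ⟨P, hP, hPv⟩ := ih
    obtain ⟨Q, hQ, hQP⟩ := exists_hecke h i P
    have hne : heckeCoeff q t i (v ∘ adj i) ≠ 0 :=
      heckeCoeff_ne_zero h (by rw [comp_adj_castSucc, comp_adj_succ]; exact hv.symm)
    refine ⟨(heckeCoeff q t i (v ∘ adj i))⁻¹ • (Q + heckeCoeff q t i v • P), ?_, fun u hu => ?_⟩
    · rw [wt_comp]
      exact (totalDegree_smul_le _ _).trans ((totalDegree_add _ _).trans
        (max_le (hQ.trans hP) ((totalDegree_smul_le _ _).trans hP)))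
    · rw [wt_comp] at hu
      have := congrFun (hecke_add_single (q := q) (t := t) hv) u
      rw [Pi.add_apply, Pi.smul_apply, Pi.smul_apply] at this
      rw [map_smul, map_add, map_smul, hQP, Pi.smul_apply, Pi.add_apply, Pi.smul_apply,
        hecke_congr hPv i u hu, hPv u hu, this, smul_smul, inv_mul_cancel₀ hne, one_smul]

/-- Polynomials of degree at most `d` are determined by their values at the spectral vectors of
weight at most `d`. -/
lemma eq_zero_of_specEval_eq_zero (h : Generic q t) {d : ℕ} {P : MvPolynomial (Fin (m + 1)) ℂ}
    (hP : P.totalDegree ≤ d) (hP0 : ∀ u, wt u ≤ d → specEval q t P u = 0) : P = 0 := by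
  let toPoly : (wtLE (m + 1) d → ℂ) →ₗ[ℂ] MvPolynomial (Fin (m + 1)) ℂ :=
    { toFun c := ∑ v, monomial (Finsupp.equivFunOnFinite.symm v.1) (c v)
      map_add' c c' := by simp [Finset.sum_add_distrib]
      map_smul' a c := by simp [Finset.smul_sum, smul_monomial] }
  let restr : CompFun m →ₗ[ℂ] (wtLE (m + 1) d → ℂ) := LinearMap.funLeft ℂ ℂ Subtype.val
  have htoPoly : ∀ P : MvPolynomial (Fin (m + 1)) ℂ, P.totalDegree ≤ d →
      toPoly (fun v => coeff (Finsupp.equivFunOnFinite.symm v.1) P) = P := by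
    intro P hP
    have hs : P.support ⊆ Finset.univ.image fun v : wtLE (m + 1) d =>
        Finsupp.equivFunOnFinite.symm v.1 := by
      intro e he
      refine Finset.mem_image.2 ⟨⟨e, mem_wtLE.2 ?_⟩, Finset.mem_univ _, ?_⟩
      · refine le_trans ?_ ((le_totalDegree he).trans hP)
        rw [Finsupp.sum_fintype _ _ fun _ => rfl]
        rfl
      · ext
        rfl
    conv_rhs => rw [P.as_sum]
    rw [Finset.sum_subset hs fun e _ he => by rw [notMem_support_iff.1 he, map_zero],
      Finset.sum_image fun v _ w _ hvw => Subtype.ext (Finsupp.equivFunOnFinite.symm.injective hvw)]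
    rfl
  let Λ : (wtLE (m + 1) d → ℂ) →ₗ[ℂ] (wtLE (m + 1) d → ℂ) := restr ∘ₗ specEval q t ∘ₗ toPoly
  have hΛ : ∀ P : MvPolynomial (Fin (m + 1)) ℂ, P.totalDegree ≤ d →
      Λ (fun v => coeff (Finsupp.equivFunOnFinite.symm v.1) P) = restr (specEval q t P) := by
    intro P hP
    simp only [Λ, LinearMap.comp_apply, htoPoly P hP]
  have hsurj : Function.Surjective Λ := by
    rw [← LinearMap.range_eq_top, eq_top_iff]
    have key : ∀ k, ∀ v : Fin (m + 1) → ℕ, d - wt v = k → wt v ≤ d →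
        restr (Pi.single v 1) ∈ LinearMap.range Λ := by
      intro k
      induction k using Nat.strong_induction_on with
      | _ k ih =>
        intro v hvk hv
        obtain ⟨N, hN, hNv⟩ := exists_newton h v
        have hsum : restr (Pi.single v 1) = restr (specEval q t N) -
            ∑ w ∈ (wtLE (m + 1) d).filter (fun w => wt v < wt w),
              specEval q t N w • restr (Pi.single w 1) := by
          funext u
          simp only [restr, Pi.sub_apply, Finset.sum_apply, Pi.smul_apply, LinearMap.funLeft_apply,
            smul_eq_mul]
          rcases le_or_gt (wt u.1) (wt v) with hu | hu
          · rw [hNv _ hu, Finset.sum_eq_zero, sub_zero]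
            intro w hw
            rw [Pi.single_eq_of_ne, mul_zero]
            intro he
            rw [he] at hu
            exact absurd (Finset.mem_filter.1 hw).2 hu.not_gt
          · rw [Finset.sum_eq_single u.1, Pi.single_eq_same, mul_one, sub_self,
              Pi.single_eq_of_ne]
            · intro he
              rw [he] at hu
              exact lt_irrefl _ hu
            · intro w _ hw
              rw [Pi.single_eq_of_ne hw.symm, mul_zero]
            · intro hn
              exact absurd (Finset.mem_filter.2 ⟨u.2, hu⟩) hn
        rw [hsum]
        refine Submodule.sub_mem _ ⟨_, hΛ N (hN.trans hv)⟩ (Submodule.sum_mem _ fun w hw => ?_)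
        rw [Finset.mem_filter, mem_wtLE] at hw
        exact Submodule.smul_mem _ _ (ih (d - wt w) (by omega) w rfl hw.1)
    intro f _
    have hf : f = ∑ v, f v • restr (Pi.single v.1 1) := by
      funext u
      simp only [Finset.sum_apply, Pi.smul_apply, restr, LinearMap.funLeft_apply, smul_eq_mul]
      rw [Finset.sum_eq_single u, Pi.single_eq_same, mul_one]
      · intro w _ hw
        rw [Pi.single_eq_of_ne fun he => hw (Subtype.ext he.symm), mul_zero]
      · simp
    rw [hf]
    exact Submodule.sum_mem _ fun v _ =>
      Submodule.smul_mem _ _ (key _ v.1 rfl (mem_wtLE.1 v.2))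
  have hinj := LinearMap.injective_iff_surjective.2 hsurj
  have h0 : Λ (fun v => coeff (Finsupp.equivFunOnFinite.symm v.1) P) = Λ 0 := by
    rw [hΛ P hP, map_zero]
    funext u
    exact hP0 u.1 (mem_wtLE.1 u.2)
  rw [← htoPoly P hP, hinj h0, map_zero]

end Unisolvence

section Newton

variable {m : ℕ} {q t : ℂ}

/-- `p` is a basis of polynomials for Newton interpolation at the spectral vectors. -/
def IsNewtonBasis (q t : ℂ) (p : (Fin (m + 1) → ℕ) → MvPolynomial (Fin (m + 1)) ℂ) : Prop :=
  ∀ v, (p v).totalDegree ≤ wt v ∧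
    ∀ u, wt u ≤ wt v → specEval q t (p v) u = Pi.single (M := fun _ => ℂ) v 1 u

/-- The operator sending Newton coefficients to values at the spectral vectors. -/
def newton (q t : ℂ) (p : (Fin (m + 1) → ℕ) → MvPolynomial (Fin (m + 1)) ℂ) :
    CompFun m →ₗ[ℂ] CompFun m where
  toFun f u := ∑ v ∈ wtLE (m + 1) (wt u), specEval q t (p v) u * f v
  map_add' f g := by
    funext u
    simp [mul_add, Finset.sum_add_distrib]
  map_smul' c f := by
    funext u
    simp only [Pi.smul_apply, smul_eq_mul, RingHom.id_apply, Finset.mul_sum]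
    exact Finset.sum_congr rfl fun v _ => by ring

/-- The values of `L f` in weight at most `d` only depend on those of `f`. -/
def IsLocal (L : CompFun m →ₗ[ℂ] CompFun m) : Prop :=
  ∀ f g d, (∀ u, wt u ≤ d → f u = g u) → ∀ u, wt u ≤ d → L f u = L g u

lemma IsLocal.comp {L L' : CompFun m →ₗ[ℂ] CompFun m} (hL : IsLocal L) (hL' : IsLocal L') :
    IsLocal (L ∘ₗ L') :=
  fun f g d hfg => hL _ _ d (hL' f g d hfg)

lemma IsLocal.ext {L L' : CompFun m →ₗ[ℂ] CompFun m} (hL : IsLocal L) (hL' : IsLocal L')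
    (h : ∀ v, L (Pi.single v 1) = L' (Pi.single v 1)) (f : CompFun m) : L f = L' f := by
  funext u
  have hf : ∀ w, wt w ≤ wt u →
      f w = (∑ v ∈ wtLE (m + 1) (wt u), f v • (Pi.single v 1 : CompFun m)) w := by
    intro w hw
    rw [Finset.sum_apply, Finset.sum_eq_single w, Pi.smul_apply, Pi.single_eq_same, smul_eq_mul,
      mul_one]
    · intro v _ hv
      rw [Pi.smul_apply, Pi.single_eq_of_ne hv.symm, smul_zero]
    · intro hn
      exact absurd (mem_wtLE.2 hw) hn
  rw [hL _ _ _ hf u le_rfl, hL' _ _ _ hf u le_rfl]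
  simp only [map_sum, map_smul, h]

lemma isLocal_hecke (i : Fin m) : IsLocal (hecke q t i) :=
  fun _ _ _ hfg => hecke_congr hfg i

lemma isLocal_raise : IsLocal (raise (m := m) q t) :=
  fun _ _ _ hfg u hu => raise_congr hfg u (Nat.le_succ_of_le hu)

lemma isLocal_mulLeft (g : CompFun m) : IsLocal (LinearMap.mulLeft ℂ g) := by
  intro f f' d hf u hu
  simp [hf u hu]

lemma isLocal_newton (p : (Fin (m + 1) → ℕ) → MvPolynomial (Fin (m + 1)) ℂ) :
    IsLocal (newton q t p) :=
  fun _ _ _ hfg _ hu => Finset.sum_congr rfl fun _ hv =>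
    congrArg _ (hfg _ ((mem_wtLE.1 hv).trans hu))

variable {p : (Fin (m + 1) → ℕ) → MvPolynomial (Fin (m + 1)) ℂ}

lemma newton_apply_of_le (hp : IsNewtonBasis q t p) (f : CompFun m) {d : ℕ}
    {u : Fin (m + 1) → ℕ} (hu : wt u ≤ d) :
    newton q t p f u = ∑ v ∈ wtLE (m + 1) d, specEval q t (p v) u * f v := by
  refine Finset.sum_subset (fun v hv => ?_) fun v _ hv => ?_
  · exact mem_wtLE.2 ((mem_wtLE.1 hv).trans hu)
  · rw [mem_wtLE, not_le] at hv
    rw [(hp v).2 u hv.le, Pi.single_eq_of_ne, zero_mul]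
    rintro rfl
    exact lt_irrefl _ hv

lemma newton_apply_eq_self (hp : IsNewtonBasis q t p) {f : CompFun m} {d : ℕ}
    (hf : ∀ u, wt u < d → f u = 0) {u : Fin (m + 1) → ℕ} (hu : wt u ≤ d) :
    newton q t p f u = f u := by
  change ∑ v ∈ wtLE (m + 1) (wt u), specEval q t (p v) u * f v = f u
  rw [Finset.sum_eq_single u, (hp u).2 u le_rfl, Pi.single_eq_same, one_mul]
  · intro v hv hvu
    rw [mem_wtLE] at hv
    rcases hv.lt_or_eq with hlt | he
    · rw [hf v (hlt.trans_le hu), mul_zero]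
    · rw [(hp v).2 u he.ge, Pi.single_eq_of_ne hvu.symm, zero_mul]
  · intro hn
    exact absurd (mem_wtLE.2 le_rfl) hn

/-- A polynomial of degree at most `d` whose values in weight at most `d` agree with a function
supported in weight `d` has this function as its Newton coefficients. -/
lemma specEval_eq_newton (h : Generic q t) (hp : IsNewtonBasis q t p) {d : ℕ}
    {P : MvPolynomial (Fin (m + 1)) ℂ} (hP : P.totalDegree ≤ d) {f : CompFun m}
    (hf : ∀ u, wt u ≠ d → f u = 0) (hPf : ∀ u, wt u ≤ d → specEval q t P u = f u) :
    specEval q t P = newton q t p f := by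
  set Q := ∑ v ∈ wtLE (m + 1) d, f v • p v with hQdef
  have hQ : Q.totalDegree ≤ d := totalDegree_finsetSum_le fun v hv =>
    (totalDegree_smul_le _ _).trans ((hp v).1.trans (mem_wtLE.1 hv))
  have hQf : specEval q t Q = newton q t p f := by
    funext u
    rw [newton_apply_of_le hp f (le_max_left (wt u) d), hQdef, map_sum, Finset.sum_apply]
    refine Finset.sum_subset_zero_on_sdiff (fun v hv => ?_) (fun v hv => ?_) fun v _ => ?_
    · exact mem_wtLE.2 ((mem_wtLE.1 hv).trans (le_max_right _ _))
    · rw [Finset.mem_sdiff, mem_wtLE, mem_wtLE] at hv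
      rw [hf v fun he => hv.2 he.le, mul_zero]
    · rw [map_smul, Pi.smul_apply, smul_eq_mul, mul_comm]
  rw [← hQf, ← sub_eq_zero, ← map_sub, eq_zero_of_specEval_eq_zero h (d := d) (P := P - Q), map_zero]
  · exact (totalDegree_sub _ _).trans (max_le hP hQ)
  · intro u hu
    rw [map_sub, Pi.sub_apply, hQf, hPf u hu,
      newton_apply_eq_self hp (fun v hv => hf v hv.ne) hu, sub_self]

lemma newton_single (h : Generic q t) (hp : IsNewtonBasis q t p) (v : Fin (m + 1) → ℕ) :
    newton q t p (Pi.single v 1) = specEval q t (p v) := by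
  refine (specEval_eq_newton h hp (hp v).1 (fun u hu => ?_) (hp v).2).symm
  rw [Pi.single_eq_of_ne]
  rintro rfl
  exact hu rfl

lemma hecke_newton (h : Generic q t) (hp : IsNewtonBasis q t p) (i : Fin m) (f : CompFun m) :
    hecke q t i (newton q t p f) = newton q t p (hecke q t i f) := by
  refine ((isLocal_hecke i).comp (isLocal_newton p)).ext
    ((isLocal_newton p).comp (isLocal_hecke i)) (fun v => ?_) f
  obtain ⟨Q, hQ, hQP⟩ := exists_hecke h i (p v)
  rw [LinearMap.comp_apply, LinearMap.comp_apply, newton_single h hp, ← hQP]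
  refine specEval_eq_newton h hp (hQ.trans (hp v).1) (hecke_single_apply i v) fun u hu => ?_
  rw [hQP, hecke_congr (hp v).2 i u hu]

lemma raise_newton (h : Generic q t) (hp : IsNewtonBasis q t p) (f : CompFun m) :
    raise q t (newton q t p f) = newton q t p (raise q t f) := by
  refine (isLocal_raise.comp (isLocal_newton p)).ext
    ((isLocal_newton p).comp isLocal_raise) (fun v => ?_) f
  rw [LinearMap.comp_apply, LinearMap.comp_apply, newton_single h hp, ← specEval_raisePoly h]
  refine specEval_eq_newton h hp (d := wt v + 1)
    ((totalDegree_raisePoly q _).trans (Nat.add_le_add_right (hp v).1 1)) (fun u hu => ?_)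
    fun u hu => ?_
  · rw [raise_single, Pi.smul_apply, Pi.single_eq_of_ne, smul_zero]
    rintro rfl
    exact hu (wt_rot v)
  · rw [specEval_raisePoly h, raise_congr (hp v).2 u hu]

/-- The Newton coefficients of the indicator function of `0` are given by `τ`. -/
lemma newton_tau (h : Generic q t) (hp : IsNewtonBasis q t p) :
    newton q t p (tau q t) = Pi.single 0 1 := by
  obtain ⟨Ξ, hΞ, hΞsymm, hΞpoly⟩ := exists_cherednik (m := m) h
  set x : CompFun m := fun u => (spec q t u (Fin.last m))⁻¹ with hx
  have hcomm : Ξ (newton q t p (tau q t)) = newton q t p (x * tau q t) := by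
    have hΞlocal : IsLocal Ξ := by
      intro f g d hfg u hu
      rw [← sub_eq_zero, ← Pi.sub_apply, ← map_sub, hΞ (f - g) (d + 1) _ u (by omega),
        Pi.sub_apply, hfg u hu, sub_self, mul_zero]
      intro v hv
      rw [Pi.sub_apply, hfg v (by omega), sub_self]
    refine (hΞlocal.comp (isLocal_newton p)).ext
      ((isLocal_newton p).comp (isLocal_mulLeft x)) (fun v => ?_) (tau q t)
    obtain ⟨Q, hQ, hQP⟩ := hΞpoly (p v)
    rw [LinearMap.comp_apply, LinearMap.comp_apply, newton_single h hp, ← hQP]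
    refine specEval_eq_newton h hp (hQ.trans (hp v).1) (fun u hu => ?_) fun u hu => ?_
    · rw [LinearMap.mulLeft_apply, Pi.mul_apply, Pi.single_eq_of_ne, mul_zero]
      rintro rfl
      exact hu rfl
    · rw [hQP, hΞ _ (wt v) _ u hu, (hp v).2 u hu]
      · rfl
      · intro w hw
        rw [(hp v).2 w hw.le, Pi.single_eq_of_ne]
        rintro rfl
        exact lt_irrefl _ hw
  set g := newton q t p (tau q t) with hg
  have hsymm : ∀ i, hecke q t i g = 0 := by
    intro i
    have : hecke q t i (tau q t) = 0 := by
      funext u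
      simp [hecke_apply, tau_comp]
    rw [hg, hecke_newton h hp, this, map_zero]
  have hraise : raise q t g = (q * t ^ m) • (Ξ g - g) := by
    rw [hg, raise_newton h hp, hcomm, ← map_sub, ← map_smul]
    congr 1
    funext u
    rw [raise_tau h]
    simp only [hx, Pi.smul_apply, Pi.sub_apply, Pi.mul_apply, smul_eq_mul]
    ring
  have hrot : ∀ v, g (rot v) = (1 - (t ^ m)⁻¹ * spec q t v 0) * g v := by
    intro v
    have h1 := congrFun hraise (rot v)
    rw [Pi.smul_apply, Pi.sub_apply, hΞsymm g hsymm, raise_rot] at h1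
    have hne := sub_ne_zero.2 (spec_rot_last_ne_one h v)
    rw [spec_rot_last] at h1 hne
    have ht := h.t_ne
    have hq := h.q_ne
    have hs := spec_ne_zero h v 0
    rw [smul_eq_mul] at h1
    field_simp at h1 ⊢
    apply mul_left_cancel₀ hne
    linear_combination h1
  funext u
  induction u using composition_induction with
  | h0 =>
    rw [hg, newton_apply_eq_self hp (d := 0) (by simp) (wt_eq_zero.2 rfl).le, tau_zero,
      Pi.single_eq_same]
  | hrot v ih =>
    have hne : rot v ≠ 0 := by
      intro he
      have := wt_rot v
      rw [he, wt_eq_zero.2 rfl] at this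
      omega
    rw [hrot, ih, Pi.single_eq_of_ne hne]
    by_cases hv : v = 0
    · subst hv
      have hlp : lp (0 : Fin (m + 1) → ℕ) 0 = 0 := by simp [lp]
      have ht := h.t_ne
      simp [spec_apply, hlp, ht]
    · rw [Pi.single_eq_of_ne hv, mul_zero]
  | hadj v i hv ih =>
    rw [comp_adj_eq_of_hecke_eq_zero h (hsymm i) v hv, ih]
    by_cases hv0 : v = 0
    · subst hv0
      simp at hv
    · rw [Pi.single_eq_of_ne hv0, Pi.single_eq_of_ne]
      intro he
      exact hv0 (by rw [← comp_adj_adj v i, he]; rfl)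

/-- Conjugation by `τ` of the Newton operator for inverted parameters inverts the Newton
operator. -/
lemma newton_mul_tau_newton_inv (h : Generic q t) (hp : IsNewtonBasis q t p)
    {p' : (Fin (m + 1) → ℕ) → MvPolynomial (Fin (m + 1)) ℂ} (hp' : IsNewtonBasis q⁻¹ t⁻¹ p')
    (w : Fin (m + 1) → ℕ) :
    newton q t p (tau q t * newton q⁻¹ t⁻¹ p' (Pi.single w 1)) =
      tau q t * (Pi.single w 1 : CompFun m) := by
  have hsmul (c : ℂ) (f g : CompFun m) : f * c • g = c • (f * g) := mul_smul_comm _ _ _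
  have hcancel {c : ℂ} (hc : c ≠ 0) {f g : CompFun m} (hfg : c • f = c • g) : f = g :=
    smul_right_injective _ hc hfg
  induction w using composition_induction with
  | h0 =>
    have h1 : newton q⁻¹ t⁻¹ p' (Pi.single 0 1) = 1 := by
      have hdeg := (hp' 0).1
      rw [wt_eq_zero.2 rfl, Nat.le_zero, totalDegree_eq_zero_iff_eq_C] at hdeg
      have h0 := (hp' 0).2 0 le_rfl
      rw [newton_single h.inv hp']
      funext u
      rw [Pi.single_eq_same, specEval_apply, hdeg, eval_C] at h0
      rw [specEval_apply, hdeg, eval_C, h0, Pi.one_apply]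
    rw [h1, mul_one, newton_tau h hp]
    funext u
    by_cases hu : u = 0
    · simp [hu, tau_zero]
    · simp [Pi.single_eq_of_ne hu]
  | hrot v ih =>
    have hne := sub_ne_zero.2 (spec_rot_last_ne_one h.inv v)
    have hc : q * t ^ m ≠ 0 := mul_ne_zero h.q_ne (pow_ne_zero _ h.t_ne)
    have := congrArg (raise q t) ih
    rw [raise_newton h hp, raise_mul_tau h, raise_mul_tau h, map_smul, raise_newton h.inv hp',
      raise_single, map_smul, hsmul, hsmul, map_smul] at this
    exact hcancel hne (hcancel hc this)
  | hadj v i hv ih =>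
    have hne : heckeCoeff q⁻¹ t⁻¹ i (v ∘ adj i) ≠ 0 :=
      heckeCoeff_ne_zero h.inv (by rw [comp_adj_castSucc, comp_adj_succ]; exact hv.symm)
    have hH : ∀ f, hecke q t i f = t • hecke q⁻¹ t⁻¹ i f := fun f => by
      rw [hecke_inv h, smul_smul, mul_inv_cancel₀ h.t_ne, one_smul]
    have := congrArg (hecke q t i) ih
    rw [hecke_newton h hp, hecke_mul_tau, hecke_mul_tau, hH, hH, hsmul, hsmul, map_smul,
      hecke_newton h.inv hp'] at this
    have h1 := hcancel h.t_ne this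
    apply hcancel hne
    rw [← hsmul, ← map_smul, ← hsmul, ← map_smul, ← hecke_add_single hv, map_add, mul_add, map_add,
      h1, map_smul, hsmul, map_smul, ih, mul_add, hsmul]

end Newton

section Interpolation

variable {m : ℕ} {q t : ℂ}

lemma cp_ne_zero (h : Generic q t) (u : Fin n → ℕ) : cp q t u ≠ 0 := by
  refine Finset.prod_ne_zero_iff.2 fun i _ => Finset.prod_ne_zero_iff.2 fun j hj => ?_
  have hj := Finset.mem_range.1 hj
  refine sub_ne_zero.2 (Ne.symm ?_)
  simpa using h.monomial_ne (b := 0) (c := leg u i j) (d := 0) (Or.inl (by omega : u i - j ≠ 0))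

lemma MM_eq_smul (h : Generic q t) (M : (Fin n → ℕ) → MvPolynomial (Fin n) ℂ) (u : Fin n → ℕ) :
    ∃ c : ℂ, c ≠ 0 ∧ MM q t M u = c • M u := by
  refine ⟨q ^ nstat' u * t ^ nstat u / cp q t u, ?_, (smul_eq_C_mul _ _).symm⟩
  exact div_ne_zero (mul_ne_zero (pow_ne_zero _ h.q_ne) (pow_ne_zero _ h.t_ne)) (cp_ne_zero h u)

lemma IsInterpFamily.exists_newtonBasis (h : Generic q t)
    {M : (Fin (m + 1) → ℕ) → MvPolynomial (Fin (m + 1)) ℂ} (hM : IsInterpFamily q t M) :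
    ∃ p, IsNewtonBasis q t p ∧ ∀ u v, qbin q t M u v = specEval q t (p v) u := by
  refine ⟨fun v => (eval (spec q t v) (M v))⁻¹ • M v, fun v => ⟨?_, fun u hu => ?_⟩,
    fun u v => ?_⟩
  · exact (totalDegree_smul_le _ _).trans (hM v).1
  · rw [map_smul, Pi.smul_apply, smul_eq_mul, specEval_apply]
    by_cases huv : u = v
    · subst huv
      rw [Pi.single_eq_same, inv_mul_cancel₀]
      intro h0
      have hM0 : M u = 0 := by
        refine eq_zero_of_specEval_eq_zero h (hM u).1 fun w hw => ?_
        by_cases hwu : w = u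
        · rw [hwu, specEval_apply, h0]
        · exact (hM u).2.2 w hw hwu
      have := (hM u).2.1
      rw [hM0, coeff_zero] at this
      exact inv_ne_zero (pow_ne_zero _ h.q_ne) this.symm
    · rw [(hM v).2.2 u hu huv, mul_zero, Pi.single_eq_of_ne huv]
  · obtain ⟨c, hc, hMM⟩ := MM_eq_smul h M v
    rw [qbin, hMM, smul_eval, smul_eval, mul_div_mul_left _ _ hc, map_smul, Pi.smul_apply,
      smul_eq_mul, specEval_apply, div_eq_inv_mul]

end Interpolation

/-- **Orthogonality of generalized q-binomial coefficients** (equation (3.9)).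
`Minv` is the interpolation family for the parameters `(q⁻¹, t⁻¹)`. -/
theorem qbin_orthogonality
    (hn : 0 < n) (q t : ℂ) (hq0 : q ≠ 0) (ht : t ≠ 0)
    (hqt : ∀ i j : ℤ, ¬(i = 0 ∧ j = 0) → q ^ i * t ^ j ≠ 1)
    (M Minv : (Fin n → ℕ) → MvPolynomial (Fin n) ℂ)
    (hM : IsInterpFamily q t M) (hMinv : IsInterpFamily q⁻¹ t⁻¹ Minv)
    (u w : Fin n → ℕ) :
    ∑ᶠ v : Fin n → ℕ,
        tau q t v / tau q t u * qbin q t M u v * qbin q⁻¹ t⁻¹ Minv v w =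
      if u = w then 1 else 0 := by
  obtain ⟨m, rfl⟩ : ∃ m, n = m + 1 := ⟨n - 1, by omega⟩
  have h : Generic q t := ⟨hq0, ht, hqt⟩
  obtain ⟨p, hp, hqbin⟩ := hM.exists_newtonBasis h
  obtain ⟨p', hp', hqbin'⟩ := hMinv.exists_newtonBasis h.inv
  have key := congrFun (newton_mul_tau_newton_inv h hp hp' w) u
  rw [newton_single h.inv hp'] at key
  have hτ := tau_ne_zero h u
  rw [finsum_eq_sum_of_support_subset (s := wtLE (m + 1) (wt u))]
  · calc
      _ = (tau q t u)⁻¹ * newton q t p (tau q t * specEval q⁻¹ t⁻¹ (p' w)) u := by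
        change _ = _ * ∑ v ∈ wtLE (m + 1) (wt u), _
        rw [Finset.mul_sum]
        refine Finset.sum_congr rfl fun v _ => ?_
        rw [hqbin, hqbin', Pi.mul_apply]
        ring
      _ = if u = w then 1 else 0 := by
        rw [key, Pi.mul_apply, inv_mul_cancel_left₀ hτ, Pi.single_apply]
  · intro v hv
    rw [Finset.mem_coe, mem_wtLE]
    by_contra! hlt
    refine hv ?_
    have hne : u ≠ v := by
      rintro rfl
      exact lt_irrefl _ hlt
    simp only [hqbin, (hp v).2 u hlt.le, Pi.single_eq_of_ne hne, mul_zero, zero_mul]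

end LRW
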